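/- (Theorem 2, achievability of the In-Network Processing scheme) Let (U_1,…,U_L) be random variables taking values in finite alphabets 𝒰_1,…,𝒰_L, jointly distributed with the sources according to a pmf of the form p(s_1,…,s_L)·∏_{l=1}^L p(u_l | s_l, u_{l-1}) (with U_0 = ∅, a constant), and let g: 𝒰_L → 𝒵̂ be a function such that E[d(φ(S_1,…,S_L), g(U_L))] ≤ D. If the rate tuple (R_1,…,R_L) satisfies R_l ≥ I(S_l, U_{l-1}; U_l | S_{l+1}) for every l = 1,…,L (where S_{L+1} = ∅, a constant), then (R_1,…,R_L) achieves distortion D. -/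

import Mathlib

namespace Cascade

structure FinPMF (Ω : Type) [Fintype Ω] where
  p : Ω → ℝ
  nonneg : ∀ ω, 0 ≤ p ω
  sum_one : ∑ ω, p ω = 1

variable {Ω : Type} [Fintype Ω]

/-- Probability that the random variable `X` takes the value `x`. -/
noncomputable def prob (μ : FinPMF Ω) {α : Type} [DecidableEq α] (X : Ω → α) (x : α) : ℝ :=
  ∑ ω ∈ Finset.univ.filter (fun ω => X ω = x), μ.p ω

/-- Expectation of a real random variable. -/
noncomputable def expect (μ : FinPMF Ω) (f : Ω → ℝ) : ℝ := ∑ ω, μ.p ω * f ω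

/-- Shannon entropy (base 2) of a finite-valued random variable. -/
noncomputable def entropy (μ : FinPMF Ω) {α : Type} [Fintype α] [DecidableEq α] (X : Ω → α) : ℝ :=
  -∑ x, prob μ X x * Real.logb 2 (prob μ X x)

/-- Conditional mutual information `I(X;Y|Z)` (base 2). -/
noncomputable def condMI (μ : FinPMF Ω) {α β γ : Type} [Fintype α] [DecidableEq α]
    [Fintype β] [DecidableEq β] [Fintype γ] [DecidableEq γ]
    (X : Ω → α) (Y : Ω → β) (Z : Ω → γ) : ℝ :=
  entropy μ (fun ω => (X ω, Z ω)) + entropy μ (fun ω => (Y ω, Z ω))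
    - entropy μ (fun ω => (X ω, Y ω, Z ω)) - entropy μ Z

/-- A cascade code: terminal `l` encodes its observed block together with the message
received from terminal `l-1` (messages are natural numbers; the message of terminal `l`
lies in `Fin (M l)`, and the initial message `m_0` is the constant `0`). -/
structure Code (L n : ℕ) (S : Fin L → Type) (Zhat : Type) where
  M : Fin L → ℕ
  M_pos : ∀ l, 0 < M l
  enc : (l : Fin L) → (Fin n → S l) → ℕ → Fin (M l)
  dec : ℕ → Fin n → Zhat

/-- `msg c s k` is the message `m_k` produced by terminal `k` (with `m_0 = 0`). -/
def msg {L n : ℕ} {S : Fin L → Type} {Zhat : Type} (c : Code L n S Zhat)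
    (s : ∀ l, Fin n → S l) : ℕ → ℕ
  | 0 => 0
  | k + 1 => if h : k < L then (c.enc ⟨k, h⟩ (s ⟨k, h⟩) (msg c s k) : ℕ) else msg c s k

/-- The i.i.d. pmf of `n` copies of the source tuple. -/
noncomputable def iidPMF {L : ℕ} {S : Fin L → Type} [∀ l, Fintype (S l)] (n : ℕ)
    (pS : (∀ l, S l) → ℝ) (h0 : ∀ s, 0 ≤ pS s) (h1 : ∑ s, pS s = 1) :
    FinPMF (Fin n → ∀ l, S l) where
  p ω := ∏ i, pS (ω i)
  nonneg ω := Finset.prod_nonneg fun i _ => h0 (ω i)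
  sum_one := by
    classical
    rw [← Fintype.piFinset_univ, ← Finset.prod_univ_sum (fun _ => Finset.univ) (fun _ s => pS s)]
    simp [h1]

/-- The reconstruction `Ẑ^n` produced by the code on source realization `ω`. -/
def reconstruct {L n : ℕ} {S : Fin L → Type} {Zhat : Type} (c : Code L n S Zhat)
    (ω : Fin n → ∀ l, S l) : Fin n → Zhat :=
  c.dec (msg c (fun l i => ω i l) L)

/-- Average per-letter distortion of the code on source realization `ω`. -/
noncomputable def avgDistortion {L n : ℕ} {S : Fin L → Type} {Zt Zhat : Type}
    (φ : (∀ l, S l) → Zt) (d : Zt → Zhat → ℝ) (c : Code L n S Zhat)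
    (ω : Fin n → ∀ l, S l) : ℝ :=
  (n : ℝ)⁻¹ * ∑ i, d (φ (ω i)) (reconstruct c ω i)

/-- The rate tuple `R` achieves distortion `D` for the cascade source coding problem. -/
def AchievesDistortion {L : ℕ} {S : Fin L → Type} [∀ l, Fintype (S l)]
    (pS : (∀ l, S l) → ℝ) (h0 : ∀ s, 0 ≤ pS s) (h1 : ∑ s, pS s = 1)
    {Zt Zhat : Type} (φ : (∀ l, S l) → Zt) (d : Zt → Zhat → ℝ)
    (R : Fin L → ℝ) (D : ℝ) : Prop :=
  ∀ ε : ℝ, 0 < ε → ∃ n : ℕ, 0 < n ∧ ∃ c : Code L n S Zhat,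
    (∀ l, Real.logb 2 (c.M l) / n ≤ R l + ε) ∧
    expect (iidPMF n pS h0 h1) (avgDistortion φ d c) ≤ D + ε

end Cascade

namespace Cascade
section Race
open MeasureTheory

/-- The standard exponential distribution on the real line. -/
noncomputable def expo : Measure ℝ :=
  (volume.restrict (Set.Ioi 0)).withDensity (fun x => ENNReal.ofReal (Real.exp (-x)))

lemma lint_exp (b c : ℝ) (hb : 0 < b) :
    ∫⁻ x in Set.Ioi c, ENNReal.ofReal (Real.exp (-b * x)) =
      ENNReal.ofReal (Real.exp (-b * c) / b) := by
  rw [← ofReal_integral_eq_lintegral_ofReal (exp_neg_integrableOn_Ioi c hb)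
    (Filter.Eventually.of_forall fun x => (Real.exp_pos _).le)]
  rw [integral_exp_mul_Ioi (by linarith)]
  congr 1
  field_simp

lemma expo_Ioi (c : ℝ) (hc : 0 ≤ c) : expo (Set.Ioi c) = ENNReal.ofReal (Real.exp (-c)) := by
  rw [expo, withDensity_apply _ measurableSet_Ioi, Measure.restrict_restrict measurableSet_Ioi,
    Set.inter_eq_left.mpr (Set.Ioi_subset_Ioi hc)]
  have := lint_exp 1 c one_pos
  simpa using this

instance : IsProbabilityMeasure expo := ⟨by
  have := lint_exp 1 0 one_pos
  rw [expo, withDensity_apply _ MeasurableSet.univ]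
  simpa using this⟩

lemma expo_lint (σ : ℝ) (hσ : 0 ≤ σ) :
    ∫⁻ x, ENNReal.ofReal (Real.exp (-σ * x)) ∂expo = ENNReal.ofReal (1 / (1 + σ)) := by
  rw [expo, lintegral_withDensity_eq_lintegral_mul _ (by fun_prop) (by fun_prop)]
  have := lint_exp (1 + σ) 0 (by linarith)
  simp only [Pi.mul_apply]
  simp only [mul_zero, Real.exp_zero] at this
  rw [← this]
  refine lintegral_congr fun x => ?_
  rw [← ENNReal.ofReal_mul (Real.exp_pos _).le, ← Real.exp_add]
  congr 2; ring

lemma expo_pos : ∀ᵐ x ∂expo, 0 < x := by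
  have h : ∀ᵐ x ∂(volume.restrict (Set.Ioi (0:ℝ))), 0 < x :=
    ae_restrict_mem measurableSet_Ioi
  exact (withDensity_absolutelyContinuous _ _).ae_le h

/-- Probability that coordinate `i` wins an exponential race. -/
lemma race_fin {N : ℕ} (i : Fin (N + 1)) (c : Fin (N + 1) → ℝ) (hc : ∀ j, 0 ≤ c j) :
    (Measure.pi fun _ : Fin (N + 1) => expo) {X | ∀ j, j ≠ i → c j * X i < X j} =
      ENNReal.ofReal (1 / (1 + ∑ j : Fin N, c (i.succAbove j))) := by
  have hmp := measurePreserving_piFinSuccAbove (fun _ : Fin (N + 1) => expo) i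
  set E : Set (ℝ × (Fin N → ℝ)) := {y | ∀ j, c (i.succAbove j) * y.1 < y.2 j} with hE
  have hEm : MeasurableSet E := by
    rw [hE, Set.ofPred_forall]
    refine MeasurableSet.iInter fun j => measurableSet_lt (by fun_prop) (by fun_prop)
  have hpre : {X : Fin (N + 1) → ℝ | ∀ j, j ≠ i → c j * X i < X j} =
      (MeasurableEquiv.piFinSuccAbove (fun _ => ℝ) i) ⁻¹' E := by
    ext X
    simp only [Set.mem_ofPred_eq, Set.mem_preimage, hE]
    constructor
    · intro h j
      exact h _ (Fin.succAbove_ne i j)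
    · intro h j hj
      obtain ⟨k, rfl⟩ := Fin.exists_succAbove_eq hj
      exact h k
  rw [hpre, hmp.measure_preimage hEm.nullMeasurableSet, Measure.prod_apply hEm]
  rw [← expo_lint _ (Finset.sum_nonneg fun j _ => hc _)]
  refine lintegral_congr_ae ?_
  filter_upwards [expo_pos] with x hx
  have : Prod.mk x ⁻¹' E = Set.univ.pi fun j => Set.Ioi (c (i.succAbove j) * x) := by
    ext y; simp [hE]
  rw [this, Measure.pi_pi]
  simp_rw [fun j => expo_Ioi _ (mul_nonneg (hc (i.succAbove j)) hx.le)]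
  rw [← ENNReal.ofReal_prod_of_nonneg (fun _ _ => (Real.exp_pos _).le), ← Real.exp_sum]
  rw [Finset.sum_neg_distrib, ← Finset.sum_mul, neg_mul]

lemma race_fin' {N : ℕ} (i : Fin (N + 1)) (c : Fin (N + 1) → ℝ) (hc : ∀ j, 0 ≤ c j)
    (hci : c i = 1) :
    (Measure.pi fun _ : Fin (N + 1) => expo).real {X | ∀ j, j ≠ i → c j * X i < X j} =
      1 / ∑ j, c j := by
  rw [measureReal_def, race_fin i c hc, ENNReal.toReal_ofReal, Fin.sum_univ_succAbove _ i, hci]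
  have := Finset.sum_nonneg fun j (_ : j ∈ Finset.univ) => hc (i.succAbove j)
  positivity

open Classical in
/-- Selection by the exponential race with weights `p`. -/
noncomputable def sel {N : ℕ} (p : Fin (N + 1) → ℝ) (X : Fin (N + 1) → ℝ) : Fin (N + 1) :=
  if h : ∃ i, ∀ j, j ≠ i → p j * X i < X j * p i then h.choose else 0

lemma sel_eq {N : ℕ} (p : Fin (N + 1) → ℝ) (X : Fin (N + 1) → ℝ) (i : Fin (N + 1))
    (h : ∀ j, j ≠ i → p j * X i < X j * p i) : sel p X = i := by
  have hex : ∃ i, ∀ j, j ≠ i → p j * X i < X j * p i := ⟨i, h⟩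
  rw [sel, dif_pos hex]
  by_contra hne
  have h1 := h _ hne
  have h2 := hex.choose_spec i (Ne.symm hne)
  linarith

lemma sel_measurable {N : ℕ} (p : Fin (N + 1) → ℝ) : Measurable (sel p) := by
  have hm : ∀ i : Fin (N + 1),
      MeasurableSet {X : Fin (N + 1) → ℝ | ∀ j, j ≠ i → p j * X i < X j * p i} := by
    intro i
    rw [Set.ofPred_forall]
    refine MeasurableSet.iInter fun j => ?_
    by_cases hj : j = i
    · simp [hj]
    · simp only [ne_eq, hj, not_false_eq_true, forall_const]
      exact measurableSet_lt (by fun_prop) (by fun_prop)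
  refine measurable_to_countable' fun i => ?_
  by_cases hi : i = 0
  · have : sel p ⁻¹' {i} = {X | ∀ j, j ≠ i → p j * X i < X j * p i} ∪
        ⋂ k, {X : Fin (N + 1) → ℝ | ∀ j, j ≠ k → p j * X k < X j * p k}ᶜ := by
      ext X
      simp only [Set.mem_preimage, Set.mem_singleton_iff, Set.mem_union, Set.mem_iInter,
        Set.mem_compl_iff]
      constructor
      · intro h
        by_cases hex : ∃ k, ∀ j, j ≠ k → p j * X k < X j * p k
        · left
          obtain ⟨k, hk⟩ := hex
          have := sel_eq p X k hk
          rw [h] at this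
          subst this
          exact hk
        · right
          intro k hk
          exact hex ⟨k, hk⟩
      · rintro (h | h)
        · exact sel_eq p X i h
        · have hex : ¬ ∃ k, ∀ j, j ≠ k → p j * X k < X j * p k := by
            rintro ⟨k, hk⟩
            exact h k hk
          rw [sel, dif_neg hex, hi]
    rw [this]
    exact (hm i).union (MeasurableSet.iInter fun k => (hm k).compl)
  · have : sel p ⁻¹' {i} = {X | ∀ j, j ≠ i → p j * X i < X j * p i} := by
      ext X
      simp only [Set.mem_preimage, Set.mem_singleton_iff]
      constructor
      · intro h
        by_cases hex : ∃ k, ∀ j, j ≠ k → p j * X k < X j * p k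
        · obtain ⟨k, hk⟩ := hex
          have := sel_eq p X k hk
          rw [h] at this
          subst this
          exact hk
        · rw [sel, dif_neg hex] at h
          exact absurd h.symm hi
      · exact sel_eq p X i
    rw [this]
    exact hm i

lemma sel_both {N : ℕ} (p q : Fin (N + 1) → ℝ) (hp : ∀ i, 0 ≤ p i) (hq : ∀ i, 0 ≤ q i)
    (hp1 : ∑ i, p i = 1) (hq1 : ∑ i, q i = 1) (i : Fin (N + 1)) :
    p i * q i / (p i + q i) ≤
      (Measure.pi fun _ : Fin (N + 1) => expo).real {X | sel p X = i ∧ sel q X = i} := by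
  rcases (hp i).eq_or_lt with h0 | hpi
  · rw [← h0]; simp
  rcases (hq i).eq_or_lt with h0 | hqi
  · rw [← h0]; simp
  set c : Fin (N + 1) → ℝ := fun j => max (p j / p i) (q j / q i) with hc
  have hc0 : ∀ j, 0 ≤ c j := fun j => le_max_of_le_left (div_nonneg (hp j) hpi.le)
  have hci : c i = 1 := by simp [hc, hpi.ne', hqi.ne']
  have hsub : {X : Fin (N + 1) → ℝ | ∀ j, j ≠ i → c j * X i < X j} ∩ {X | 0 < X i} ⊆
      {X | sel p X = i ∧ sel q X = i} := by
    rintro X ⟨hX, hX0⟩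
    have hX0' : 0 < X i := hX0
    refine ⟨sel_eq p X i fun j hj => ?_, sel_eq q X i fun j hj => ?_⟩
    · have h1 := hX j hj
      have h2 : p j / p i * X i ≤ c j * X i :=
        mul_le_mul_of_nonneg_right (le_max_left _ _) hX0'.le
      have h3 : p j / p i * X i < X j := lt_of_le_of_lt h2 h1
      rw [div_mul_eq_mul_div, div_lt_iff₀ hpi] at h3
      exact h3
    · have h1 := hX j hj
      have h2 : q j / q i * X i ≤ c j * X i :=
        mul_le_mul_of_nonneg_right (le_max_right _ _) hX0'.le
      have h3 : q j / q i * X i < X j := lt_of_le_of_lt h2 h1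
      rw [div_mul_eq_mul_div, div_lt_iff₀ hqi] at h3
      exact h3
  have hpos : ∀ᵐ X ∂(Measure.pi fun _ : Fin (N + 1) => expo), 0 < X i :=
    (Measure.tendsto_eval_ae_ae (μ := fun _ : Fin (N + 1) => expo) (i := i)).eventually expo_pos
  have hmeas : (Measure.pi fun _ : Fin (N + 1) => expo).real
      ({X : Fin (N + 1) → ℝ | ∀ j, j ≠ i → c j * X i < X j} ∩ {X | 0 < X i}) = 1 / ∑ j, c j := by
    rw [← race_fin' i c hc0 hci]
    refine measureReal_congr ?_
    filter_upwards [hpos] with X hX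
    apply propext
    constructor
    · exact fun h => h.1
    · exact fun h => ⟨h, hX⟩
  have hle : 1 / ∑ j, c j ≤
      (Measure.pi fun _ : Fin (N + 1) => expo).real {X | sel p X = i ∧ sel q X = i} := by
    rw [← hmeas]
    exact measureReal_mono hsub
  refine le_trans ?_ hle
  have hsum : ∑ j, c j ≤ 1 / p i + 1 / q i := by
    calc ∑ j, c j ≤ ∑ j, (p j / p i + q j / q i) := by
          refine Finset.sum_le_sum fun j _ => ?_
          exact max_le (le_add_of_nonneg_right (div_nonneg (hq j) hqi.le))
            (le_add_of_nonneg_left (div_nonneg (hp j) hpi.le))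
      _ = 1 / p i + 1 / q i := by
          rw [Finset.sum_add_distrib, ← Finset.sum_div, ← Finset.sum_div, hp1, hq1]
  have hsp : 0 < ∑ j, c j :=
    Finset.sum_pos' (fun j _ => hc0 j) ⟨i, Finset.mem_univ _, by rw [hci]; exact one_pos⟩
  calc p i * q i / (p i + q i) = 1 / (1 / p i + 1 / q i) := by
        field_simp; ring
    _ ≤ 1 / ∑ j, c j := one_div_le_one_div_of_le hsp hsum

lemma sel_one {N : ℕ} (p : Fin (N + 1) → ℝ) (hp : ∀ i, 0 ≤ p i)
    (hp1 : ∑ i, p i = 1) (i : Fin (N + 1)) :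
    p i ≤ (Measure.pi fun _ : Fin (N + 1) => expo).real {X | sel p X = i} := by
  rcases (hp i).eq_or_lt with h0 | hpi
  · rw [← h0]; positivity
  set c : Fin (N + 1) → ℝ := fun j => p j / p i with hc
  have hc0 : ∀ j, 0 ≤ c j := fun j => (div_nonneg (hp j) hpi.le)
  have hci : c i = 1 := by simp [hc, hpi.ne']
  have hsub : {X : Fin (N + 1) → ℝ | ∀ j, j ≠ i → c j * X i < X j} ⊆ {X | sel p X = i} := by
    intro X hX
    refine sel_eq p X i fun j hj => ?_
    have h3 := hX j hj
    simp only [hc] at h3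
    rw [div_mul_eq_mul_div, div_lt_iff₀ hpi] at h3
    exact h3
  refine le_trans (le_of_eq ?_) (measureReal_mono hsub)
  rw [race_fin' i c hc0 hci, ← Finset.sum_div, hp1]
  simp

/-- The matching lemma on a finite alphabet. -/
lemma match_fin {K : Type} [Fintype K] [DecidableEq K] {N : ℕ} (p : K → Fin (N + 1) → ℝ)
    (hp : ∀ k i, 0 ≤ p k i) (hp1 : ∀ k, ∑ i, p k i = 1) :
    ∃ ν : FinPMF (K → Fin (N + 1)),
      (∀ k i, ∑ f, ν.p f * (if f k = i then 1 else 0) = p k i) ∧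
      (∀ k k' i, p k i * p k' i / (p k i + p k' i) ≤
        ∑ f, ν.p f * (if f k = i ∧ f k' = i then 1 else 0)) := by
  classical
  set P := (Measure.pi fun _ : Fin (N + 1) => expo) with hP
  set F : (Fin (N + 1) → ℝ) → (K → Fin (N + 1)) := fun X k => sel (p k) X with hF
  have hFm : Measurable F := measurable_pi_lambda _ fun k => sel_measurable (p k)
  set Q := P.map F with hQ
  have : IsProbabilityMeasure Q := Measure.isProbabilityMeasure_map hFm.aemeasurable
  have key : ∀ (A : (K → Fin (N + 1)) → Prop) [DecidablePred A],
      ∑ f, Q.real {f} * (if A f then 1 else 0) = P.real {X | A (F X)} := by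
    intro A _
    simp only [mul_ite, mul_one, mul_zero]
    rw [← Finset.sum_filter, sum_measureReal_singleton, hQ,
      map_measureReal_apply hFm (Set.toFinite _).measurableSet]
    congr 1
    ext X; simp
  let ν : FinPMF (K → Fin (N + 1)) :=
    { p := fun f => Q.real {f}
      nonneg := fun f => measureReal_nonneg
      sum_one := by
        have := key (fun _ => True)
        simpa using this }
  have hge : ∀ k i, p k i ≤ ∑ f, ν.p f * (if f k = i then 1 else 0) := by
    intro k i
    refine le_trans (sel_one (p k) (hp k) (hp1 k) i) (le_of_eq ?_)
    exact (key (fun f => f k = i)).symm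
  refine ⟨ν, fun k i => ?_, fun k k' i => ?_⟩
  · have htot : ∑ i, ∑ f, ν.p f * (if f k = i then 1 else 0) = ∑ i, p k i := by
      rw [hp1, Finset.sum_comm]
      simp only [mul_ite, mul_one, mul_zero, Finset.sum_ite_eq, Finset.mem_univ, if_true]
      exact ν.sum_one
    have := (Finset.sum_eq_sum_iff_of_le fun i _ => hge k i).mp htot.symm
    exact (this i (Finset.mem_univ _)).symm
  · refine le_trans (sel_both (p k) (p k') (hp k) (hp k') (hp1 k) (hp1 k') i) (le_of_eq ?_)
    exact (key (fun f => f k = i ∧ f k' = i)).symm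

lemma match_gen {K A : Type} [Fintype K] [Fintype A] [DecidableEq A] [DecidableEq K]
    (p : K → A → ℝ) [Nonempty A]
    (hp : ∀ k i, 0 ≤ p k i) (hp1 : ∀ k, ∑ i, p k i = 1) :
    ∃ ν : FinPMF (K → A),
      (∀ k i, ∑ f, ν.p f * (if f k = i then 1 else 0) = p k i) ∧
      (∀ k k' i, p k i * p k' i / (p k i + p k' i) ≤
        ∑ f, ν.p f * (if f k = i ∧ f k' = i then 1 else 0)) := by
  obtain ⟨N, hN⟩ : ∃ N, Fintype.card A = N + 1 :=
    Nat.exists_eq_succ_of_ne_zero Fintype.card_ne_zero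
  let e : A ≃ Fin (N + 1) := Fintype.equivFinOfCardEq hN
  obtain ⟨ν, h1, h2⟩ := match_fin (fun k i => p k (e.symm i)) (fun k i => hp k _)
    (fun k => by rw [← hp1 k]; exact Equiv.sum_comp e.symm (p k))
  let E : (K → A) ≃ (K → Fin (N + 1)) := Equiv.arrowCongr (Equiv.refl K) e
  have hE : ∀ f k, E f k = e (f k) := fun f k => rfl
  refine ⟨⟨fun f => ν.p (E f), fun f => ν.nonneg _, ?_⟩, fun k i => ?_, fun k k' i => ?_⟩
  · rw [← ν.sum_one]; exact Equiv.sum_comp E ν.p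
  · have := h1 k (e i)
    rw [← Equiv.sum_comp E] at this
    simpa [hE] using this
  · have := h2 k k' (e i)
    rw [← Equiv.sum_comp E] at this
    simpa [hE] using this

end Race

/-- One stage of the scheme: joint randomness for an encoder and a decoder. -/
lemma stage {C B A : Type} [Fintype C] [DecidableEq C] [Fintype B] [DecidableEq B]
    [Fintype A] [DecidableEq A] [Nonempty A] (M : ℕ) (hM : 0 < M)
    (q : C → A → ℝ) (hq0 : ∀ c a, 0 ≤ q c a) (hq1 : ∀ c, ∑ a, q c a = 1)
    (Q : B → A → ℝ) (hQ0 : ∀ c a, 0 ≤ Q c a) (hQ1 : ∀ c, ∑ a, Q c a = 1) :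
    ∃ ν : FinPMF (C ⊕ (B × Fin M) → A × Fin M),
      (∀ c a, ∑ f, ν.p f * (if (f (.inl c)).1 = a then 1 else 0) = q c a) ∧
      (∀ c b a, ∑ f, ν.p f * (if (f (.inl c)).1 = a ∧
          (f (.inr (b, (f (.inl c)).2))).1 ≠ a then 1 else 0) ≤
        q c a * (q c a / (q c a + M * Q b a))) := by
  have : NeZero M := ⟨hM.ne'⟩
  have hMr : (0 : ℝ) < M := by exact_mod_cast hM
  obtain ⟨ν, h1, h2⟩ := match_gen (K := C ⊕ (B × Fin M)) (A := A × Fin M)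
    (fun k am => match k with
      | .inl c => q c am.1 / M
      | .inr bm => if am.2 = bm.2 then Q bm.1 am.1 else 0)
    (by
      rintro (c | bm) am
      · exact div_nonneg (hq0 _ _) hMr.le
      · dsimp only
        split_ifs
        · exact hQ0 _ _
        · exact le_rfl)
    (by
      rintro (c | bm)
      · rw [Fintype.sum_prod_type]
        simp only [Finset.sum_const, Finset.card_univ, Fintype.card_fin, nsmul_eq_mul]
        rw [← hq1 c]
        refine Finset.sum_congr rfl fun a _ => ?_
        field_simp
      · rw [Fintype.sum_prod_type]
        simp [hQ1])
  have hq : ∀ c a, ∑ f, ν.p f * (if (f (.inl c)).1 = a then 1 else 0) = q c a := by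
    intro c a
    have : ∀ f : C ⊕ (B × Fin M) → A × Fin M,
        ν.p f * (if (f (.inl c)).1 = a then 1 else 0) =
        ∑ m, ν.p f * (if f (.inl c) = (a, m) then 1 else 0) := by
      intro f
      rw [← Finset.mul_sum]
      congr 1
      by_cases h : (f (.inl c)).1 = a
      · simp [Prod.ext_iff, h]
      · simp [Prod.ext_iff, h]
    simp_rw [this]
    rw [Finset.sum_comm]
    simp_rw [h1 (.inl c)]
    simp
    field_simp
  refine ⟨ν, hq, ?_⟩
  intro c b a
  have : ∀ f : C ⊕ (B × Fin M) → A × Fin M,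
      ν.p f * (if (f (.inl c)).1 = a ∧ (f (.inr (b, (f (.inl c)).2))).1 ≠ a then 1 else 0) ≤
      ∑ m, (ν.p f * (if f (.inl c) = (a, m) then 1 else 0) -
        ν.p f * (if f (.inl c) = (a, m) ∧ f (.inr (b, m)) = (a, m) then 1 else 0)) := by
    intro f
    simp_rw [← mul_sub]
    rw [← Finset.mul_sum]
    refine mul_le_mul_of_nonneg_left ?_ (ν.nonneg f)
    have hnn : ∀ m, (0 : ℝ) ≤ (if f (.inl c) = (a, m) then 1 else 0) -
        (if f (.inl c) = (a, m) ∧ f (.inr (b, m)) = (a, m) then 1 else 0) := by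
      intro m
      by_cases h : f (.inl c) = (a, m)
      · simp only [h, true_and, if_true]
        split_ifs <;> norm_num
      · simp [h]
    split_ifs with h
    · refine le_trans ?_ (Finset.single_le_sum (fun m _ => hnn m)
        (Finset.mem_univ (f (.inl c)).2))
      have e1 : f (.inl c) = (a, (f (.inl c)).2) := Prod.ext h.1 rfl
      have e2 : ¬ f (.inr (b, (f (.inl c)).2)) = (a, (f (.inl c)).2) := by
        intro h'
        exact h.2 (by rw [h'])
      rw [if_pos e1, if_neg (fun hh => e2 hh.2)]
      norm_num
    · exact Finset.sum_nonneg fun m _ => hnn m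
  refine le_trans (Finset.sum_le_sum fun f _ => this f) ?_
  rw [Finset.sum_comm]
  simp_rw [Finset.sum_sub_distrib, h1 (.inl c)]
  have h3 : ∀ m : Fin M, q c a / M * Q b a / (q c a / M + Q b a) ≤
      ∑ f, ν.p f * (if f (.inl c) = (a, m) ∧ f (.inr (b, m)) = (a, m) then 1 else 0) := by
    intro m
    have := h2 (.inl c) (.inr (b, m)) (a, m)
    simpa using this
  have h4 := Finset.sum_le_sum fun m (_ : m ∈ Finset.univ) => h3 m
  simp only [Finset.sum_const, Finset.card_univ, Fintype.card_fin, nsmul_eq_mul] at h4 ⊢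
  have h5 : (M : ℝ) * (q c a / M) - M * (q c a / M * Q b a / (q c a / M + Q b a)) ≤
      q c a * (q c a / (q c a + M * Q b a)) := by
    rcases (hq0 c a).eq_or_lt with h0 | hpos
    · rw [← h0]; simp
    · have hd : 0 < q c a + M * Q b a := by have := hQ0 b a; positivity
      have hd' : 0 < q c a / M + Q b a := by have := hQ0 b a; positivity
      apply le_of_eq
      field_simp
      ring
  linarith


section OneShot

lemma sum_pi_prod {ι : Type} [Fintype ι] [DecidableEq ι] {W : ι → Type} [∀ i, Fintype (W i)]
    (f : ∀ i, W i → ℝ) : ∑ w : ∀ i, W i, ∏ i, f i (w i) = ∏ i, ∑ x, f i x := by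
  classical
  rw [← Fintype.piFinset_univ, ← Finset.prod_univ_sum (fun _ => Finset.univ) f]

/-- The masked tuple carrying the previous auxiliary. -/
def pv {L : ℕ} {U : Fin (L + 1) → Type} (l : Fin (L + 1)) (u : ∀ j, U j) : ∀ j, Option (U j) :=
  fun j => if (j : ℕ) + 1 = (l : ℕ) then some (u j) else none

/-- The masked tuple carrying the next source. -/
def nx {L : ℕ} {S : Fin (L + 1) → Type} (l : Fin (L + 1)) (s : ∀ j, S j) : ∀ j, Option (S j) :=
  fun j => if (j : ℕ) = (l : ℕ) + 1 then some (s j) else none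

variable {L n : ℕ} {S U : Fin (L + 1) → Type} {Zhat : Type}

/-- Shared randomness of stage `l`. -/
abbrev WT (n : ℕ) (S U : Fin (L + 1) → Type) (M : Fin (L + 1) → ℕ) (l : Fin (L + 1)) : Type :=
  (((Fin n → S l) × (∀ j, Option (U j))) ⊕ ((∀ j, Option (Fin n → S j)) × Fin (M l))) →
    U l × Fin (M l)

/-- Decoding of the previous auxiliary at terminal `l`. -/
def prevDec (M : Fin (L + 1) → ℕ) (hM : ∀ l, 0 < M l) (w : ∀ l, WT n S U M l)
    (l : Fin (L + 1)) (s : Fin n → S l) (m : ℕ) : ∀ j, Option (U j) := fun j =>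
  if (j : ℕ) + 1 = (l : ℕ) then
    some (w j (.inr (Function.update (fun _ => none) l (some s),
      ⟨m % M j, Nat.mod_lt _ (hM j)⟩))).1
  else none

/-- The code associated with a realization of the shared randomness. -/
def codeOf (M : Fin (L + 1) → ℕ) (hM : ∀ l, 0 < M l) (w : ∀ l, WT n S U M l)
    (G : U (Fin.last L) → Fin n → Zhat) : Code (L + 1) n S Zhat where
  M := M
  M_pos := hM
  enc l s m := (w l (.inl (s, prevDec M hM w l s m))).2
  dec m := G (w (Fin.last L) (.inr (fun _ => none, ⟨m % M _, Nat.mod_lt _ (hM _)⟩))).1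

lemma nx_last (s : ∀ j, S j) : nx (Fin.last L) s = fun _ => none := by
  funext j
  have := j.isLt
  simp only [nx, Fin.val_last]
  rw [if_neg (by omega)]

lemma nx_prev (s : ∀ j, S j) (j l : Fin (L + 1)) (h : (j : ℕ) + 1 = l) :
    nx j s = Function.update (fun _ => none) l (some (s l)) := by
  funext k
  by_cases hk : k = l
  · subst hk
    simp [nx, h]
  · rw [Function.update_of_ne hk, nx, if_neg]
    intro h'
    exact hk (Fin.ext (by omega))

lemma chain_exists (F : ∀ l : Fin (L + 1), (∀ j, Option (U j)) → U l) (u0 : ∀ l, U l) :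
    ∃ u : ∀ l, U l, ∀ l, F l (pv l u) = u l := by
  have : ∀ k : ℕ, ∃ u : ∀ l, U l, ∀ l : Fin (L + 1), (l : ℕ) < k → F l (pv l u) = u l := by
    intro k
    induction k with
    | zero => exact ⟨u0, fun l hl => absurd hl (by omega)⟩
    | succ k ih =>
      obtain ⟨u, hu⟩ := ih
      by_cases hk : k < L + 1
      · refine ⟨Function.update u ⟨k, hk⟩ (F ⟨k, hk⟩ (pv ⟨k, hk⟩ u)), fun l hl => ?_⟩
        have hpv : pv l (Function.update u ⟨k, hk⟩ (F ⟨k, hk⟩ (pv ⟨k, hk⟩ u))) = pv l u := by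
          funext j
          simp only [pv]
          by_cases hj : (j : ℕ) + 1 = l
          · rw [if_pos hj, if_pos hj, Function.update_of_ne]
            intro h
            rw [h] at hj
            simp only at hj
            omega
          · rw [if_neg hj, if_neg hj]
        rw [hpv]
        by_cases hlk : l = ⟨k, hk⟩
        · subst hlk
          simp
        · rw [Function.update_of_ne hlk]
          apply hu
          have : (l : ℕ) ≠ k := fun h => hlk (Fin.ext h)
          omega
      · refine ⟨u, fun l hl => hu l (by have := l.isLt; omega)⟩
  obtain ⟨u, hu⟩ := this (L + 1)
  exact ⟨u, fun l => hu l l.isLt⟩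

lemma code_correct (M : Fin (L + 1) → ℕ) (hM : ∀ l, 0 < M l) (w : ∀ l, WT n S U M l)
    (G : U (Fin.last L) → Fin n → Zhat) (s : ∀ l, Fin n → S l) (u : ∀ l, U l)
    (hdec : ∀ l, (w l (.inr (nx l s, (w l (.inl (s l, pv l u))).2))).1 = u l) :
    (codeOf M hM w G).dec (msg (codeOf M hM w G) s (L + 1)) = G (u (Fin.last L)) := by
  have key : ∀ k (hk : k < L + 1), msg (codeOf M hM w G) s (k + 1) =
      ((w ⟨k, hk⟩ (.inl (s ⟨k, hk⟩, pv ⟨k, hk⟩ u))).2 : ℕ) := by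
    intro k
    induction k with
    | zero =>
      intro hk
      rw [msg, dif_pos hk]
      have : prevDec M hM w ⟨0, hk⟩ (s ⟨0, hk⟩) (msg (codeOf M hM w G) s 0) = pv ⟨0, hk⟩ u := by
        funext j
        simp [prevDec, pv]
      simp only [codeOf] at this ⊢
      rw [this]
    | succ k ih =>
      intro hk
      have ih' := ih (by omega)
      rw [msg, dif_pos hk]
      have : prevDec M hM w ⟨k + 1, hk⟩ (s ⟨k + 1, hk⟩) (msg (codeOf M hM w G) s (k + 1)) =
          pv ⟨k + 1, hk⟩ u := by
        funext j
        simp only [prevDec, pv]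
        by_cases hj : (j : ℕ) + 1 = k + 1
        · rw [if_pos hj, if_pos hj]
          obtain ⟨j, hjlt⟩ := j
          obtain rfl : j = k := by simpa using hj
          rw [ih']
          congr 1
          rw [← hdec, nx_prev s ⟨j, hjlt⟩ ⟨j + 1, hk⟩ rfl]
          congr 4
          exact Fin.ext (Nat.mod_eq_of_lt (Fin.isLt _))
        · rw [if_neg hj, if_neg hj]
      simp only [codeOf] at this ⊢
      rw [this]
  rw [key L (by omega)]
  change G _ = _
  congr 1
  have h := hdec (Fin.last L)
  rw [nx_last] at h
  rw [← h]
  congr 4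
  exact Fin.ext (Nat.mod_eq_of_lt (Fin.isLt _))

variable [∀ l, Fintype (S l)] [∀ l, DecidableEq (S l)]
    [∀ l, Fintype (U l)] [∀ l, DecidableEq (U l)]

set_option synthInstance.maxHeartbeats 400000 in
set_option synthInstance.maxSize 10000 in
set_option maxHeartbeats 1000000 in
lemma one_shot (p : (∀ l, Fin n → S l) → ℝ) (hp0 : ∀ s, 0 ≤ p s)
    (q : (l : Fin (L + 1)) → (Fin n → S l) → (∀ j, Option (U j)) → U l → ℝ)
    (hq0 : ∀ l s v u, 0 ≤ q l s v u) (hq1 : ∀ l s v, ∑ u, q l s v u = 1)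
    (Q : (l : Fin (L + 1)) → (∀ j, Option (Fin n → S j)) → U l → ℝ)
    (hQ0 : ∀ l t u, 0 ≤ Q l t u) (hQ1 : ∀ l t, ∑ u, Q l t u = 1)
    (u0 : ∀ l, U l)
    (M : Fin (L + 1) → ℕ) (hM : ∀ l, 0 < M l)
    (G : U (Fin.last L) → Fin n → Zhat)
    (cost : (∀ l, Fin n → S l) → (Fin n → Zhat) → ℝ) (B : ℝ)
    (hc0 : ∀ s z, 0 ≤ cost s z) (hcB : ∀ s z, cost s z ≤ B) :
    ∃ c : Code (L + 1) n S Zhat, c.M = M ∧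
      ∑ s, p s * cost s (c.dec (msg c s (L + 1))) ≤
      ∑ s, ∑ u : ∀ l, U l, p s * (∏ l, q l (s l) (pv l u) (u l)) *
        (cost s (G (u (Fin.last L))) + B * ∑ l, q l (s l) (pv l u) (u l) /
          (q l (s l) (pv l u) (u l) + M l * Q l (nx l s) (u l))) := by
  have hne : ∀ l, Nonempty (U l) := fun l => ⟨u0 l⟩
  choose ν hν1 hν2 using fun l : Fin (L + 1) =>
    stage (C := (Fin n → S l) × (∀ j, Option (U j))) (B := ∀ j, Option (Fin n → S j))
      (A := U l) (M l) (hM l) (fun c => q l c.1 c.2) (fun c => hq0 l c.1 c.2)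
      (fun c => hq1 l c.1 c.2) (Q l) (hQ0 l) (hQ1 l)
  set pw : (∀ l, WT n S U M l) → ℝ := fun w => ∏ l, (ν l).p (w l) with hpw
  have hpw0 : ∀ w, 0 ≤ pw w := fun w => Finset.prod_nonneg fun l _ => (ν l).nonneg _
  have hpw1 : ∑ w, pw w = 1 := by
    rw [hpw, sum_pi_prod (fun l x => (ν l).p x)]
    exact Finset.prod_eq_one fun l _ => (ν l).sum_one
  set RHS := ∑ s, ∑ u : ∀ l, U l, p s * (∏ l, q l (s l) (pv l u) (u l)) *
        (cost s (G (u (Fin.last L))) + B * ∑ l, q l (s l) (pv l u) (u l) /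
          (q l (s l) (pv l u) (u l) + M l * Q l (nx l s) (u l))) with hRHS
  set T : (∀ l, WT n S U M l) → (∀ l, Fin n → S l) → ℝ := fun w s =>
    cost s ((codeOf M hM w G).dec (msg (codeOf M hM w G) s (L + 1))) with hT
  -- indicator functions
  set a : (∀ l, Fin n → S l) → (∀ l, U l) → ∀ l, WT n S U M l → ℝ := fun s u l x =>
    if (x (.inl (s l, pv l u))).1 = u l then 1 else 0 with ha
  set b : (∀ l, Fin n → S l) → (∀ l, U l) → ∀ l, WT n S U M l → ℝ := fun s u l x =>
    if (x (.inl (s l, pv l u))).1 = u l ∧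
      (x (.inr (nx l s, (x (.inl (s l, pv l u))).2))).1 ≠ u l then 1 else 0 with hb
  have ha0 : ∀ s u l x, 0 ≤ a s u l x := by
    intro s u l x; simp only [ha]; split_ifs <;> norm_num
  have hb0 : ∀ s u l x, 0 ≤ b s u l x := by
    intro s u l x; simp only [hb]; split_ifs <;> norm_num
  have hB0 : ∀ s : (∀ l, Fin n → S l), 0 ≤ B := fun s =>
    (hc0 s (G (u0 _))).trans (hcB s (G (u0 _)))
  have hpt : ∀ w s, T w s ≤ ∑ u, ((∏ l, a s u l (w l)) * cost s (G (u (Fin.last L))) +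
      B * ∑ l, ∏ j, (if j = l then b s u j (w j) else a s u j (w j))) := by
    intro w s
    obtain ⟨u, hu⟩ := chain_exists (fun l v => (w l (.inl (s l, v))).1) u0
    have hnn : ∀ u l, 0 ≤ ∏ j, (if j = l then b s u j (w j) else a s u j (w j)) := by
      intro u l
      refine Finset.prod_nonneg fun j _ => ?_
      split_ifs
      · exact hb0 _ _ _ _
      · exact ha0 _ _ _ _
    refine le_trans ?_ (Finset.single_le_sum (f := fun u => (∏ l, a s u l (w l)) *
      cost s (G (u (Fin.last L))) +
      B * ∑ l, ∏ j, (if j = l then b s u j (w j) else a s u j (w j))) (fun u _ => ?_)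
      (Finset.mem_univ u))
    · have ha1 : ∀ l, a s u l (w l) = 1 := by
        intro l; simp only [ha]; rw [if_pos (hu l)]
      simp only [ha1]
      rw [Finset.prod_const_one, one_mul]
      by_cases hdec : ∀ l, (w l (.inr (nx l s, (w l (.inl (s l, pv l u))).2))).1 = u l
      · simp only [hT]
        rw [code_correct M hM w G s u hdec]
        have : 0 ≤ B * ∑ l, ∏ j, (if j = l then b s u j (w j) else 1) := by
          refine mul_nonneg (hB0 s) (Finset.sum_nonneg fun l _ => ?_)
          have := hnn u l
          simpa only [ha1] using this
        linarith
      · push Not at hdec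
        obtain ⟨l, hl⟩ := hdec
        have h1 : (1 : ℝ) ≤ ∑ l, ∏ j, (if j = l then b s u j (w j) else 1) := by
          refine le_trans ?_ (Finset.single_le_sum (f := fun l =>
            ∏ j, (if j = l then b s u j (w j) else 1)) (fun l _ => ?_) (Finset.mem_univ l))
          · rw [Finset.prod_ite_eq' Finset.univ l (fun j => b s u j (w j))]
            simp only [Finset.mem_univ, if_true, hb]
            rw [if_pos ⟨hu l, hl⟩]
          · have := hnn u l
            simpa only [ha1] using this
        have h2 : T w s ≤ B := hcB _ _
        have h3 := hc0 s (G (u (Fin.last L)))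
        nlinarith [hB0 s, mul_le_mul_of_nonneg_left h1 (hB0 s)]
    · refine add_nonneg (mul_nonneg (Finset.prod_nonneg fun l _ => ha0 _ _ _ _) (hc0 _ _))
        (mul_nonneg (hB0 s) (Finset.sum_nonneg fun l _ => hnn u l))
  have hA : ∀ s u, ∑ w, pw w * ∏ l, a s u l (w l) = ∏ l, q l (s l) (pv l u) (u l) := by
    intro s u
    simp only [hpw, ← Finset.prod_mul_distrib]
    rw [sum_pi_prod (fun l x => (ν l).p x * a s u l x)]
    exact Finset.prod_congr rfl fun l _ => hν1 l (s l, pv l u) (u l)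
  have hBd : ∀ s u l, ∑ w, pw w * ∏ j, (if j = l then b s u j (w j) else a s u j (w j)) ≤
      (∏ l, q l (s l) (pv l u) (u l)) * (q l (s l) (pv l u) (u l) /
          (q l (s l) (pv l u) (u l) + M l * Q l (nx l s) (u l))) := by
    intro s u l
    simp only [hpw, ← Finset.prod_mul_distrib]
    rw [sum_pi_prod (fun j x => (ν j).p x * (if j = l then b s u j x else a s u j x))]
    have hr : (q l (s l) (pv l u) (u l) /
          (q l (s l) (pv l u) (u l) + M l * Q l (nx l s) (u l))) =
        ∏ j, (if j = l then (q j (s j) (pv j u) (u j) /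
          (q j (s j) (pv j u) (u j) + M j * Q j (nx j s) (u j))) else 1) := by
      rw [Finset.prod_ite_eq' Finset.univ l]; simp
    rw [hr, ← Finset.prod_mul_distrib]
    refine Finset.prod_le_prod (fun j _ => ?_) (fun j _ => ?_)
    · refine Finset.sum_nonneg fun x _ => mul_nonneg ((ν j).nonneg _) ?_
      split_ifs
      · exact hb0 _ _ _ _
      · exact ha0 _ _ _ _
    · by_cases hj : j = l
      · subst hj
        simp only [if_true]
        exact hν2 _ _ _ _
      · simp only [hj, if_false, mul_one]
        exact (hν1 j (s j, pv j u) (u j)).le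
  have hs : ∀ s, ∑ w, pw w * T w s ≤ ∑ u : ∀ l, U l, (∏ l, q l (s l) (pv l u) (u l)) *
        (cost s (G (u (Fin.last L))) + B * ∑ l, q l (s l) (pv l u) (u l) /
          (q l (s l) (pv l u) (u l) + M l * Q l (nx l s) (u l))) := by
    intro s
    calc ∑ w, pw w * T w s ≤ ∑ w, pw w * ∑ u, ((∏ l, a s u l (w l)) *
          cost s (G (u (Fin.last L))) +
          B * ∑ l, ∏ j, (if j = l then b s u j (w j) else a s u j (w j))) :=
          Finset.sum_le_sum fun w _ => mul_le_mul_of_nonneg_left (hpt w s) (hpw0 w)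
      _ = ∑ u, ((∑ w, pw w * ∏ l, a s u l (w l)) * cost s (G (u (Fin.last L))) +
          B * ∑ l, ∑ w, pw w * ∏ j, (if j = l then b s u j (w j) else a s u j (w j))) := by
          simp_rw [Finset.mul_sum]
          rw [Finset.sum_comm]
          refine Finset.sum_congr rfl fun u _ => ?_
          simp_rw [mul_add]
          rw [Finset.sum_add_distrib, Finset.sum_mul]
          congr 1
          · exact Finset.sum_congr rfl fun w _ => by ring
          · simp_rw [Finset.mul_sum]
            rw [Finset.sum_comm]
            exact Finset.sum_congr rfl fun l _ => Finset.sum_congr rfl fun w _ => by ring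
      _ ≤ _ := by
          refine Finset.sum_le_sum fun u _ => ?_
          rw [hA, mul_add]
          have := Finset.sum_le_sum fun l (_ : l ∈ Finset.univ) => hBd s u l
          rw [← Finset.mul_sum] at this
          have := mul_le_mul_of_nonneg_left this (hB0 s)
          linarith
  have htot : ∑ w, pw w * ∑ s, p s * T w s ≤ RHS := by
    calc ∑ w, pw w * ∑ s, p s * T w s = ∑ s, p s * ∑ w, pw w * T w s := by
          simp_rw [Finset.mul_sum]
          rw [Finset.sum_comm]
          exact Finset.sum_congr rfl fun s _ => Finset.sum_congr rfl fun w _ => by ring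
      _ ≤ _ := by
          rw [hRHS]
          refine Finset.sum_le_sum fun s _ => ?_
          refine (mul_le_mul_of_nonneg_left (hs s) (hp0 s)).trans (le_of_eq ?_)
          rw [Finset.mul_sum]
          exact Finset.sum_congr rfl fun u _ => by ring
  by_contra hcon
  push Not at hcon
  have hall : ∀ w, RHS < ∑ s, p s * T w s := fun w => hcon (codeOf M hM w G) rfl
  have hlt : RHS < ∑ w, pw w * ∑ s, p s * T w s := by
    calc RHS = ∑ w, pw w * RHS := by rw [← Finset.sum_mul, hpw1, one_mul]
      _ < _ := by
        have hex : ∃ w, 0 < pw w := by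
          by_contra h
          push Not at h
          have : ∑ w, pw w ≤ 0 := Finset.sum_nonpos fun w _ => h w
          linarith
        obtain ⟨w, hw⟩ := hex
        refine Finset.sum_lt_sum (fun w _ => mul_le_mul_of_nonneg_left (hall w).le (hpw0 w))
          ⟨w, Finset.mem_univ _, mul_lt_mul_of_pos_left (hall w) hw⟩
  linarith

end OneShot


section Info

variable {Ω : Type} [Fintype Ω] (μ : FinPMF Ω)

lemma prob_nonneg {α : Type} [DecidableEq α] (X : Ω → α) (x : α) : 0 ≤ prob μ X x :=
  Finset.sum_nonneg fun ω _ => μ.nonneg ω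

lemma le_prob {α : Type} [DecidableEq α] (X : Ω → α) (ω : Ω) : μ.p ω ≤ prob μ X (X ω) :=
  Finset.single_le_sum (f := fun ω => μ.p ω) (fun ω _ => μ.nonneg ω) (by simp)

lemma sum_prob_mul {α : Type} [Fintype α] [DecidableEq α] (X : Ω → α) (f : α → ℝ) :
    ∑ x, prob μ X x * f x = ∑ ω, μ.p ω * f (X ω) := by
  simp only [prob, Finset.sum_mul]
  rw [← Finset.sum_fiberwise (s := Finset.univ) (g := X) (f := fun ω => μ.p ω * f (X ω))]
  refine Finset.sum_congr rfl fun x _ => Finset.sum_congr rfl fun ω hω => ?_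
  rw [(Finset.mem_filter.mp hω).2]

lemma sum_prob {α : Type} [Fintype α] [DecidableEq α] (X : Ω → α) :
    ∑ x, prob μ X x = 1 := by
  have := sum_prob_mul μ X (fun _ => 1)
  simpa [μ.sum_one] using this

lemma sum_prob_pair {α β : Type} [Fintype α] [DecidableEq α] [Fintype β] [DecidableEq β]
    (X : Ω → α) (Y : Ω → β) (y : β) :
    ∑ x, prob μ (fun ω => (X ω, Y ω)) (x, y) = prob μ Y y := by
  have h1 := sum_prob_mul μ (fun ω => (X ω, Y ω)) (fun z => if z.2 = y then 1 else 0)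
  have h2 := sum_prob_mul μ Y (fun z => if z = y then 1 else 0)
  simp only at h1
  rw [← h2, Fintype.sum_prod_type] at h1
  simpa using h1

lemma entropy_eq {α : Type} [Fintype α] [DecidableEq α] (X : Ω → α) :
    entropy μ X * Real.log 2 = -∑ ω, μ.p ω * Real.log (prob μ X (X ω)) := by
  rw [entropy, sum_prob_mul μ X (fun x => Real.logb 2 (prob μ X x)), neg_mul, Finset.sum_mul]
  congr 1
  refine Finset.sum_congr rfl fun ω _ => ?_
  rw [mul_assoc, Real.logb, div_mul_cancel₀]
  exact (Real.log_pos one_lt_two).ne'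

/-- Gibbs inequality. -/
lemma gibbs {κ β : Type} [Fintype κ] [DecidableEq κ] [Fintype β] [DecidableEq β]
    (C : Ω → κ) (Y : Ω → β) (J : Ω → ℝ)
    (hJ : ∀ ω, J ω = prob μ (fun ω => (C ω, Y ω)) (C ω, Y ω))
    (r : κ → β → ℝ) (hr0 : ∀ c y, 0 ≤ r c y)
    (hr1 : ∀ c, ∑ y, r c y = 1) (hpos : ∀ ω, 0 < μ.p ω → 0 < r (C ω) (Y ω)) :
    ∑ ω, μ.p ω * Real.log (r (C ω) (Y ω)) ≤
      ∑ ω, μ.p ω * (Real.log (J ω) - Real.log (prob μ C (C ω))) := by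
  rw [← sub_nonpos, ← Finset.sum_sub_distrib]
  set h : κ × β → ℝ := fun z => r z.1 z.2 * prob μ C z.1 / prob μ (fun ω => (C ω, Y ω)) z with hh
  have hpt : ∀ ω, μ.p ω * Real.log (r (C ω) (Y ω)) -
      μ.p ω * (Real.log (J ω) - Real.log (prob μ C (C ω))) ≤
      μ.p ω * h (C ω, Y ω) - μ.p ω := by
    intro ω
    rcases (μ.nonneg ω).eq_or_lt with h0 | hp
    · rw [← h0]; simp
    have h1 : 0 < prob μ C (C ω) := lt_of_lt_of_le hp (le_prob μ C ω)
    have h2 : 0 < J ω := by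
      rw [hJ]
      exact lt_of_lt_of_le hp (le_prob μ (fun ω => (C ω, Y ω)) ω)
    have h3 := hpos ω hp
    have h4 : h (C ω, Y ω) = r (C ω) (Y ω) * prob μ C (C ω) / J ω := by
      rw [hJ]
    have h5 : Real.log (h (C ω, Y ω)) = Real.log (r (C ω) (Y ω)) + Real.log (prob μ C (C ω)) -
        Real.log (J ω) := by
      rw [h4, Real.log_div (by positivity) h2.ne', Real.log_mul h3.ne' h1.ne']
    have h6 := Real.log_le_sub_one_of_pos (x := h (C ω, Y ω)) (by rw [h4]; positivity)
    rw [h5] at h6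
    nlinarith [mul_le_mul_of_nonneg_left h6 hp.le]
  refine (Finset.sum_le_sum fun ω _ => hpt ω).trans ?_
  rw [Finset.sum_sub_distrib, μ.sum_one, ← sum_prob_mul μ (fun ω => (C ω, Y ω)) h]
  have h1 : ∀ z, prob μ (fun ω => (C ω, Y ω)) z * h z ≤ r z.1 z.2 * prob μ C z.1 := by
    intro z
    have hnn := mul_nonneg (hr0 z.1 z.2) (prob_nonneg μ C z.1)
    simp only [hh]
    by_cases hz : prob μ (fun ω => (C ω, Y ω)) z = 0
    · rw [hz]; simpa using hnn
    · rw [mul_div_cancel₀ _ hz]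
  have h2 := Finset.sum_le_sum fun z (_ : z ∈ Finset.univ) => h1 z
  have h3 : ∑ z : κ × β, r z.1 z.2 * prob μ C z.1 = 1 := by
    rw [Fintype.sum_prod_type]
    simp_rw [← Finset.sum_mul, hr1, one_mul]
    exact sum_prob μ C
  linarith

/-- Conditional pmf of `Y` given `Z` (uniform where the condition has probability zero). -/
noncomputable def condK {β γ : Type} [Fintype β] [DecidableEq β] [DecidableEq γ]
    (Y : Ω → β) (Z : Ω → γ) (z : γ) (y : β) : ℝ :=
  if prob μ Z z = 0 then 1 / Fintype.card β else prob μ (fun ω => (Y ω, Z ω)) (y, z) / prob μ Z z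

lemma condK_nonneg {β γ : Type} [Fintype β] [DecidableEq β] [DecidableEq γ]
    (Y : Ω → β) (Z : Ω → γ) (z : γ) (y : β) : 0 ≤ condK μ Y Z z y := by
  rw [condK]
  split_ifs
  · positivity
  · exact div_nonneg (prob_nonneg _ _ _) (prob_nonneg _ _ _)

lemma condK_sum {β γ : Type} [Fintype β] [DecidableEq β] [Fintype γ] [DecidableEq γ] [Nonempty β]
    (Y : Ω → β) (Z : Ω → γ) (z : γ) : ∑ y, condK μ Y Z z y = 1 := by
  simp only [condK]
  split_ifs with h
  · simp
  · rw [← Finset.sum_div, sum_prob_pair, div_self h]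

lemma condK_pos {β γ : Type} [Fintype β] [DecidableEq β] [DecidableEq γ]
    (Y : Ω → β) (Z : Ω → γ) (ω : Ω) (hω : 0 < μ.p ω) :
    condK μ Y Z (Z ω) (Y ω) = prob μ (fun ω => (Y ω, Z ω)) (Y ω, Z ω) / prob μ Z (Z ω) ∧
      0 < prob μ (fun ω => (Y ω, Z ω)) (Y ω, Z ω) ∧ 0 < prob μ Z (Z ω) ∧
      0 < condK μ Y Z (Z ω) (Y ω) := by
  have h1 := lt_of_lt_of_le hω (le_prob μ Z ω)
  have h2 := lt_of_lt_of_le hω (le_prob μ (fun ω => (Y ω, Z ω)) ω)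
  have h3 : condK μ Y Z (Z ω) (Y ω) =
      prob μ (fun ω => (Y ω, Z ω)) (Y ω, Z ω) / prob μ Z (Z ω) := by
    rw [condK, if_neg h1.ne']
  exact ⟨h3, h2, h1, by rw [h3]; exact div_pos h2 h1⟩

lemma condMI_bounds {α β γ : Type} [Fintype α] [DecidableEq α]
    [Fintype β] [DecidableEq β] [Fintype γ] [DecidableEq γ] [Nonempty β]
    (X : Ω → α) (Y : Ω → β) (Z : Ω → γ) (k : α → β → ℝ) (hk0 : ∀ x y, 0 ≤ k x y)
    (hk1 : ∀ x, ∑ y, k x y = 1) (hkpos : ∀ ω, 0 < μ.p ω → 0 < k (X ω) (Y ω)) :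
    0 ≤ condMI μ X Y Z ∧
    ∑ ω, μ.p ω * (Real.log (k (X ω) (Y ω)) - Real.log (condK μ Y Z (Z ω) (Y ω))) ≤
      condMI μ X Y Z * Real.log 2 := by
  have hl2 := Real.log_pos one_lt_two
  set J : Ω → ℝ := fun ω => prob μ (fun ω => (X ω, Y ω, Z ω)) (X ω, Y ω, Z ω) with hJdef
  have hJ : ∀ ω, J ω = prob μ (fun ω => ((X ω, Z ω), Y ω)) ((X ω, Z ω), Y ω) := by
    intro ω
    simp only [hJdef, prob]
    congr 1
    ext ω'
    simp only [Finset.mem_filter, Finset.mem_univ, true_and, Prod.mk.injEq]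
    tauto
  have hMI : condMI μ X Y Z * Real.log 2 =
      ∑ ω, μ.p ω * (Real.log (J ω) - Real.log (prob μ (fun ω => (X ω, Z ω)) (X ω, Z ω))) -
      ∑ ω, μ.p ω * Real.log (condK μ Y Z (Z ω) (Y ω)) := by
    have hQ : ∑ ω, μ.p ω * Real.log (condK μ Y Z (Z ω) (Y ω)) =
        ∑ ω, (μ.p ω * Real.log (prob μ (fun ω => (Y ω, Z ω)) (Y ω, Z ω)) -
          μ.p ω * Real.log (prob μ Z (Z ω))) := by
      refine Finset.sum_congr rfl fun ω _ => ?_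
      rcases (μ.nonneg ω).eq_or_lt with h0 | hp
      · rw [← h0]; simp
      obtain ⟨h1, h2, h3, _⟩ := condK_pos μ Y Z ω hp
      rw [h1, Real.log_div h2.ne' h3.ne', mul_sub]
    rw [hQ]
    simp only [mul_sub, Finset.sum_sub_distrib]
    rw [condMI, sub_mul, sub_mul, add_mul, entropy_eq, entropy_eq, entropy_eq, entropy_eq]
    ring
  have g1 := gibbs μ (fun ω => (X ω, Z ω)) Y J hJ (fun c y => k c.1 y) (fun c y => hk0 _ _)
    (fun c => hk1 c.1) hkpos
  have g2 := gibbs μ (fun ω => (X ω, Z ω)) Y J hJ (fun c y => condK μ Y Z c.2 y)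
    (fun c y => condK_nonneg μ Y Z _ _)
    (fun c => condK_sum μ Y Z c.2) (fun ω hω => (condK_pos μ Y Z ω hω).2.2.2)
  simp only at g1 g2
  constructor
  · have : 0 ≤ condMI μ X Y Z * Real.log 2 := by rw [hMI]; linarith
    exact nonneg_of_mul_nonneg_left this hl2
  · simp only [mul_sub] at hMI g1 ⊢
    simp only [Finset.sum_sub_distrib] at hMI g1 ⊢
    linarith

/-- Chernoff-type bound: a negative mean gives an exponential moment below one. -/
lemma chernoff (f : Ω → ℝ) (hf : ∑ ω, μ.p ω * f ω < 0) :
    ∃ t : ℝ, 0 < t ∧ t ≤ 1 ∧ ∑ ω, μ.p ω * Real.exp (t * f ω) < 1 := by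
  set m := ∑ ω, μ.p ω * f ω with hm
  set K := 1 + ∑ ω, |f ω| with hK
  have hfK : ∀ ω, |f ω| ≤ K := by
    intro ω
    have := Finset.single_le_sum (f := fun ω => |f ω|) (fun ω _ => abs_nonneg _)
      (Finset.mem_univ ω)
    linarith
  have hK1 : 1 ≤ K := by
    have := Finset.sum_nonneg (fun ω (_ : ω ∈ Finset.univ) => abs_nonneg (f ω))
    linarith
  set t := min (1 / K) (-m / (2 * K ^ 2)) with ht
  have ht0 : 0 < t := lt_min (by positivity) (div_pos (by linarith) (by positivity))
  have htK : t * K ≤ 1 := by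
    have : t ≤ 1 / K := min_le_left _ _
    rwa [le_div_iff₀ (by positivity)] at this
  have htm : t * (2 * K ^ 2) ≤ -m := by
    have : t ≤ -m / (2 * K ^ 2) := min_le_right _ _
    rwa [le_div_iff₀ (by positivity)] at this
  refine ⟨t, ht0, by nlinarith, ?_⟩
  have hpt : ∀ ω, Real.exp (t * f ω) ≤ 1 + t * f ω + t ^ 2 * K ^ 2 := by
    intro ω
    have habs : |t * f ω| ≤ t * K := by
      rw [abs_mul, abs_of_pos ht0]
      exact mul_le_mul_of_nonneg_left (hfK ω) ht0.le
    have h1 := Real.abs_exp_sub_one_sub_id_le (habs.trans htK)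
    have h2 := (abs_le.mp h1).2
    have h3 : (t * f ω) ^ 2 ≤ (t * K) ^ 2 := sq_le_sq' (by linarith [(abs_le.mp habs).1])
      (abs_le.mp habs).2
    nlinarith
  calc ∑ ω, μ.p ω * Real.exp (t * f ω) ≤ ∑ ω, μ.p ω * (1 + t * f ω + t ^ 2 * K ^ 2) :=
        Finset.sum_le_sum fun ω _ => mul_le_mul_of_nonneg_left (hpt ω) (μ.nonneg ω)
    _ = (∑ ω, μ.p ω) * (1 + t ^ 2 * K ^ 2) + t * m := by
        rw [hm, Finset.sum_mul, Finset.mul_sum, ← Finset.sum_add_distrib]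
        exact Finset.sum_congr rfl fun ω _ => by ring
    _ < 1 := by
        rw [μ.sum_one]
        nlinarith [mul_le_mul_of_nonneg_left htm ht0.le, mul_pos ht0 (neg_pos.mpr hf)]

lemma ratio_le (a b y t : ℝ) (ha : 0 < a) (hb : 0 < b) (ht0 : 0 < t) (ht1 : t ≤ 1)
    (h : a ≤ b * Real.exp y) : a / (a + b) ≤ Real.exp (t * y) := by
  rcases le_or_gt 0 y with hy | hy
  · have h1 : a / (a + b) ≤ 1 := by rw [div_le_one (by positivity)]; linarith
    exact h1.trans (Real.one_le_exp (by positivity))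
  · have h1 : a / (a + b) ≤ Real.exp y := by
      rw [div_le_iff₀ (by positivity)]
      nlinarith [Real.exp_pos y]
    exact h1.trans (Real.exp_le_exp.mpr (by nlinarith))

lemma sum_iid_pow {n : ℕ} (f : Ω → ℝ) :
    ∑ ω : Fin n → Ω, ∏ i, f (ω i) = (∑ ω, f ω) ^ n := by
  classical
  rw [sum_pi_prod (fun (_ : Fin n) x => f x)]
  simp

lemma sum_iid_avg {n : ℕ} (hn : 0 < n) (h : Ω → ℝ) :
    ∑ ω : Fin n → Ω, (∏ i, μ.p (ω i)) * ((n : ℝ)⁻¹ * ∑ i, h (ω i)) = ∑ ω, μ.p ω * h ω := by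
  classical
  have h1 : ∀ i : Fin n, ∑ ω : Fin n → Ω, (∏ i, μ.p (ω i)) * h (ω i) = ∑ ω, μ.p ω * h ω := by
    intro i
    have : ∀ ω : Fin n → Ω, (∏ i, μ.p (ω i)) * h (ω i) =
        ∏ j, (μ.p (ω j) * if j = i then h (ω j) else 1) := by
      intro ω
      rw [Finset.prod_mul_distrib, Finset.prod_ite_eq' Finset.univ i (fun j => h (ω j))]
      simp
    simp_rw [this]
    rw [sum_pi_prod (fun (j : Fin n) x => μ.p x * if j = i then h x else 1)]
    rw [Finset.prod_eq_single i]
    · simp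
    · intro j _ hj
      simp [hj, μ.sum_one]
    · simp
  have hn' : (n : ℝ) ≠ 0 := by exact_mod_cast hn.ne'
  calc _ = (n : ℝ)⁻¹ * ∑ i : Fin n, ∑ ω : Fin n → Ω, (∏ i, μ.p (ω i)) * h (ω i) := by
        rw [Finset.sum_comm, Finset.mul_sum]
        refine Finset.sum_congr rfl fun ω _ => ?_
        rw [← Finset.mul_sum]; ring
    _ = _ := by
        simp_rw [h1]
        simp
        field_simp

end Info


section Final

/-- Transposition between blocks of letters and letters of blocks. -/
def blockEquiv (n : ℕ) {L : ℕ} (S U : Fin (L + 1) → Type) :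
    (Fin n → (∀ l, S l) × (∀ l, U l)) ≃ (∀ l, Fin n → S l) × (∀ l, Fin n → U l) where
  toFun ω := (fun l i => (ω i).1 l, fun l i => (ω i).2 l)
  invFun x i := (fun l => x.1 l i, fun l => x.2 l i)
  left_inv _ := rfl
  right_inv _ := rfl

lemma pv_map {L n : ℕ} {U : Fin (L + 1) → Type} (l : Fin (L + 1)) (u : ∀ j, Fin n → U j)
    (i : Fin n) : (fun j => (pv (U := fun j => Fin n → U j) l u j).map (fun f => f i)) =
      pv l (fun j => u j i) := by
  funext j
  simp only [pv]
  split_ifs <;> rfl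

lemma nx_map {L n : ℕ} {U : Fin (L + 1) → Type} (l : Fin (L + 1)) (u : ∀ j, Fin n → U j)
    (i : Fin n) : (fun j => (nx (S := fun j => Fin n → U j) l u j).map (fun f => f i)) =
      nx l (fun j => u j i) := by
  funext j
  simp only [nx]
  split_ifs <;> rfl

lemma block_ratio {Ω : Type} [Fintype Ω] (μ : FinPMF Ω) {n : ℕ} (a b : Ω → ℝ)
    (ha : ∀ ω, 0 < μ.p ω → 0 < a ω) (hb : ∀ ω, 0 < μ.p ω → 0 < b ω) (c t M : ℝ)
    (ht0 : 0 < t) (ht1 : t ≤ 1) (hM : Real.exp (n * c) ≤ M) (ω : Fin n → Ω) :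
    (∏ i, μ.p (ω i)) * ((∏ i, a (ω i)) / ((∏ i, a (ω i)) + M * ∏ i, b (ω i))) ≤
      ∏ i, (μ.p (ω i) * Real.exp (t * (Real.log (a (ω i)) - Real.log (b (ω i)) - c))) := by
  by_cases h0 : ∃ i, μ.p (ω i) = 0
  · obtain ⟨i, hi⟩ := h0
    rw [Finset.prod_eq_zero (Finset.mem_univ i) hi, zero_mul]
    exact Finset.prod_nonneg fun i _ => mul_nonneg (μ.nonneg _) (Real.exp_pos _).le
  · push Not at h0
    have hp : ∀ i, 0 < μ.p (ω i) := fun i => lt_of_le_of_ne (μ.nonneg _) (h0 i).symm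
    rw [Finset.prod_mul_distrib]
    refine mul_le_mul_of_nonneg_left ?_ (Finset.prod_nonneg fun i _ => μ.nonneg _)
    rw [← Real.exp_sum, ← Finset.mul_sum]
    have hA : 0 < ∏ i, a (ω i) := Finset.prod_pos fun i _ => ha _ (hp i)
    have hB : 0 < ∏ i, b (ω i) := Finset.prod_pos fun i _ => hb _ (hp i)
    have hM0 : 0 < M := lt_of_lt_of_le (Real.exp_pos _) hM
    refine ratio_le _ _ _ t hA (mul_pos hM0 hB) ht0 ht1 ?_
    have he : Real.exp (∑ i, (Real.log (a (ω i)) - Real.log (b (ω i)) - c)) =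
        (∏ i, a (ω i)) / (∏ i, b (ω i)) / Real.exp (n * c) := by
      rw [Finset.sum_sub_distrib, Finset.sum_sub_distrib, Real.exp_sub, Real.exp_sub,
        Real.exp_sum, Real.exp_sum]
      simp only [Finset.sum_const, Finset.card_univ, Fintype.card_fin, nsmul_eq_mul]
      congr 2
      · exact Finset.prod_congr rfl fun i _ => Real.exp_log (ha _ (hp i))
      · exact Finset.prod_congr rfl fun i _ => Real.exp_log (hb _ (hp i))
    rw [he]
    have hE := Real.exp_pos (n * c)
    calc (∏ i, a (ω i)) = (∏ i, a (ω i)) * 1 := (mul_one _).symm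
      _ ≤ (∏ i, a (ω i)) * (M / Real.exp (n * c)) :=
          mul_le_mul_of_nonneg_left ((one_le_div hE).mpr hM) hA.le
      _ = _ := by field_simp

lemma floor_bounds (n : ℕ) (R ε : ℝ) (hR : 0 ≤ R) (hε : 0 < ε) (hn : 2 ≤ n * ε) :
    Real.exp (n * ((R + ε / 2) * Real.log 2)) ≤ (⌊(2 : ℝ) ^ (n * (R + ε))⌋₊ : ℝ) ∧
    0 < ⌊(2 : ℝ) ^ (n * (R + ε))⌋₊ ∧
    Real.logb 2 (⌊(2 : ℝ) ^ (n * (R + ε))⌋₊ : ℝ) / n ≤ R + ε := by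
  have hn0 : (0 : ℝ) < n := by
    rcases (Nat.cast_nonneg (α := ℝ) n).eq_or_lt with h | h
    · rw [← h] at hn; norm_num at hn
    · exact h
  have hy : Real.exp (n * ((R + ε / 2) * Real.log 2)) = (2 : ℝ) ^ (n * (R + ε / 2)) := by
    rw [Real.rpow_def_of_pos two_pos]; congr 1; ring
  have hy1 : (1 : ℝ) ≤ (2 : ℝ) ^ (n * (R + ε / 2)) :=
    Real.one_le_rpow one_le_two (by positivity)
  have hx : 2 * (2 : ℝ) ^ (n * (R + ε / 2)) ≤ (2 : ℝ) ^ (n * (R + ε)) := by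
    have : (2 : ℝ) ^ (n * (R + ε)) = (2 : ℝ) ^ (n * (R + ε / 2)) * (2 : ℝ) ^ (n * ε / 2) := by
      rw [← Real.rpow_add two_pos]; congr 1; ring
    rw [this, mul_comm]
    refine mul_le_mul_of_nonneg_left ?_ (by linarith)
    calc (2 : ℝ) = 2 ^ (1 : ℝ) := (Real.rpow_one 2).symm
      _ ≤ _ := Real.rpow_le_rpow_of_exponent_le one_le_two (by linarith)
  have hfl := Nat.lt_floor_add_one ((2 : ℝ) ^ (n * (R + ε)))
  have hfu := Nat.floor_le (a := (2 : ℝ) ^ (n * (R + ε))) (by positivity)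
  have hmain : (2 : ℝ) ^ (n * (R + ε / 2)) ≤ (⌊(2 : ℝ) ^ (n * (R + ε))⌋₊ : ℝ) := by linarith
  have hpos : (0 : ℝ) < (⌊(2 : ℝ) ^ (n * (R + ε))⌋₊ : ℝ) := by linarith
  refine ⟨by rw [hy]; exact hmain, by exact_mod_cast hpos, ?_⟩
  rw [div_le_iff₀ hn0]
  have := (Real.logb_le_logb (b := 2) one_lt_two hpos (by positivity)).mpr hfu
  rw [Real.logb_rpow two_pos (by norm_num)] at this
  linarith

end Final


/-- **Theorem 2 (achievability of the In-Network Processing scheme).**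
Terminals are indexed by `Fin (L+1)` (so there is at least one terminal, `Fin.last L` being
Terminal `L`).  The auxiliaries `(U_1,…,U_L)` are jointly distributed with the sources
according to a pmf of the form `p(s_1,…,s_L) ∏_l p(u_l | s_l, u_{l-1})` (with `U_0 = ∅`, a
constant): the kernel at stage `l` depends on `u_{l-1}`, encoded as the masked tuple
`fun j => if j+1 = l then some (u j) else none`, which is constantly `none` for `l = 0`.
Given `g : 𝒰_L → 𝒵̂` with `E[d(φ(S), g(U_L))] ≤ D`, any rate tuple with
`R_l ≥ I(S_l, U_{l-1}; U_l | S_{l+1})` (where `S_{L+1} = ∅` is encoded by the masked tuple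
`fun j => if j = l+1 then some (s j) else none`, constantly `none` when `l` is the last
index) achieves distortion `D`. -/
theorem in_network_processing_achievability
    {L : ℕ} {S U : Fin (L + 1) → Type}
    [∀ l, Fintype (S l)] [∀ l, DecidableEq (S l)]
    [∀ l, Fintype (U l)] [∀ l, DecidableEq (U l)]
    {Zt Zhat : Type} [Fintype Zt] [Fintype Zhat]
    (φ : (∀ l, S l) → Zt) (d : Zt → Zhat → ℝ) (hd : ∀ z zh, 0 ≤ d z zh)
    (pS : (∀ l, S l) → ℝ) (hpS0 : ∀ s, 0 ≤ pS s) (hpS1 : ∑ s, pS s = 1)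
    (μ : FinPMF ((∀ l, S l) × (∀ l, U l)))
    (q : (l : Fin (L + 1)) → S l → (∀ j, Option (U j)) → U l → ℝ)
    (hq0 : ∀ l s v u, 0 ≤ q l s v u)
    (hq1 : ∀ l s v, ∑ u, q l s v u = 1)
    (hfact : ∀ s u, μ.p (s, u) =
      pS s * ∏ l, q l (s l)
        (fun j => if (j : ℕ) + 1 = (l : ℕ) then some (u j) else none) (u l))
    (g : U (Fin.last L) → Zhat)
    (D : ℝ) (hdist : expect μ (fun ω => d (φ ω.1) (g (ω.2 (Fin.last L)))) ≤ D)
    (R : Fin (L + 1) → ℝ)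
    (hR : ∀ l : Fin (L + 1),
      condMI μ
        (fun ω => (ω.1 l,
          fun j : Fin (L + 1) => if (j : ℕ) + 1 = (l : ℕ) then some (ω.2 j) else none))
        (fun ω => ω.2 l)
        (fun ω => fun j : Fin (L + 1) => if (j : ℕ) = (l : ℕ) + 1 then some (ω.1 j) else none) ≤ R l) :
    AchievesDistortion pS hpS0 hpS1 φ d R D := by
  intro ε hε
  have hl2 := Real.log_pos one_lt_two
  have hΩ : Nonempty ((∀ l, S l) × (∀ l, U l)) := by
    by_contra h
    rw [not_nonempty_iff] at h
    have := μ.sum_one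
    simp at this
  obtain ⟨s0, u0⟩ := hΩ
  have hU : ∀ l, Nonempty (U l) := fun l => ⟨u0 l⟩
  have hfact' : ∀ ω : (∀ l, S l) × (∀ l, U l), μ.p ω =
      pS ω.1 * ∏ l, q l (ω.1 l) (pv l ω.2) (ω.2 l) := fun ω => hfact ω.1 ω.2
  have hqpos : ∀ l (ω : (∀ l, S l) × (∀ l, U l)), 0 < μ.p ω →
      0 < q l (ω.1 l) (pv l ω.2) (ω.2 l) := by
    intro l ω hω
    refine lt_of_le_of_ne (hq0 _ _ _ _) fun h => ?_
    rw [hfact', Finset.prod_eq_zero (Finset.mem_univ l) h.symm, mul_zero] at hω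
    exact lt_irrefl _ hω
  set Qk : (l : Fin (L + 1)) → (∀ j, Option (S j)) → U l → ℝ := fun l =>
    condK μ (fun ω => ω.2 l) (fun ω => nx l ω.1) with hQk
  have hQpos : ∀ l (ω : (∀ l, S l) × (∀ l, U l)), 0 < μ.p ω →
      0 < Qk l (nx l ω.1) (ω.2 l) := fun l ω hω =>
    (condK_pos μ (fun ω => ω.2 l) (fun ω => nx l ω.1) ω hω).2.2.2
  have hMI := fun l => condMI_bounds μ (fun ω => (ω.1 l, pv l ω.2)) (fun ω => ω.2 l)
    (fun ω => nx l ω.1) (fun x y => q l x.1 x.2 y) (fun x y => hq0 _ _ _ _)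
    (fun x => hq1 _ _ _) (hqpos l)
  have hR' : ∀ l, condMI μ (fun ω => (ω.1 l, pv l ω.2)) (fun ω => ω.2 l)
    (fun ω => nx l ω.1) ≤ R l := hR
  have hR0 : ∀ l, 0 ≤ R l := fun l => (hMI l).1.trans (hR' l)
  set f : Fin (L + 1) → (∀ l, S l) × (∀ l, U l) → ℝ := fun l ω =>
    Real.log (q l (ω.1 l) (pv l ω.2) (ω.2 l)) - Real.log (Qk l (nx l ω.1) (ω.2 l)) -
      (R l + ε / 2) * Real.log 2 with hf
  have hfneg : ∀ l, ∑ ω, μ.p ω * f l ω < 0 := by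
    intro l
    have h1 := (hMI l).2
    have h2 := mul_le_mul_of_nonneg_right (hR' l) hl2.le
    have h3 : ∑ ω, μ.p ω * f l ω = ∑ ω, μ.p ω * (Real.log (q l (ω.1 l) (pv l ω.2) (ω.2 l)) -
        Real.log (Qk l (nx l ω.1) (ω.2 l))) - (R l + ε / 2) * Real.log 2 := by
      simp only [hf, mul_sub, Finset.sum_sub_distrib, ← Finset.sum_mul, μ.sum_one, one_mul]
    have h4 : 0 < ε / 2 * Real.log 2 := by positivity
    rw [h3]
    simp only [hQk] at h1 ⊢
    linarith
  choose t ht0 ht1 hρ using fun l => chernoff μ (f l) (hfneg l)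
  set ρ : Fin (L + 1) → ℝ := fun l => ∑ ω, μ.p ω * Real.exp (t l * f l ω) with hρdef
  have hρ0 : ∀ l, 0 ≤ ρ l := fun l =>
    Finset.sum_nonneg fun ω _ => mul_nonneg (μ.nonneg _) (Real.exp_pos _).le
  set B : ℝ := ∑ z, ∑ zh, d z zh with hB
  have hdB : ∀ z zh, d z zh ≤ B := by
    intro z zh
    refine (Finset.single_le_sum (f := fun zh => d z zh) (fun zh _ => hd z zh)
      (Finset.mem_univ zh)).trans ?_
    exact Finset.single_le_sum (f := fun z => ∑ zh, d z zh)
      (fun z _ => Finset.sum_nonneg fun zh _ => hd z zh) (Finset.mem_univ z)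
  have hB0 : 0 ≤ B := Finset.sum_nonneg fun z _ => Finset.sum_nonneg fun zh _ => hd z zh
  have hlim : Filter.Tendsto (fun n : ℕ => B * ∑ l, ρ l ^ n) Filter.atTop (nhds 0) := by
    have h1 : Filter.Tendsto (fun n : ℕ => ∑ l, ρ l ^ n) Filter.atTop
        (nhds (∑ _l : Fin (L + 1), (0 : ℝ))) :=
      tendsto_finsetSum _ fun l _ => tendsto_pow_atTop_nhds_zero_of_lt_one (hρ0 l) (hρ l)
    have h2 := h1.const_mul B
    simpa using h2
  have hev1 := hlim.eventually (gt_mem_nhds hε)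
  have hev2 := Filter.eventually_ge_atTop (⌈2 / ε⌉₊)
  obtain ⟨n, ⟨hn1, hn2⟩, hn⟩ := ((hev1.and hev2).and (Filter.eventually_gt_atTop 0)).exists
  have hnε : 2 ≤ n * ε := by
    have h1 : 2 / ε ≤ n := (Nat.le_ceil _).trans (by exact_mod_cast hn2)
    rwa [div_le_iff₀ hε] at h1
  have hn0 : (0 : ℝ) < n := by exact_mod_cast hn
  have hfb := fun l => floor_bounds n (R l) ε (hR0 l) hε hnε
  set M : Fin (L + 1) → ℕ := fun l => ⌊(2 : ℝ) ^ (n * (R l + ε))⌋₊ with hMdef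
  set cost : (∀ l, Fin n → S l) → (Fin n → Zhat) → ℝ := fun s z =>
    (n : ℝ)⁻¹ * ∑ i, d (φ (fun l => s l i)) (z i) with hcost
  obtain ⟨c, hcM, hcD⟩ := one_shot (n := n) (S := S) (U := fun l => Fin n → U l)
    (fun s => ∏ i, pS (fun l => s l i)) (fun s => Finset.prod_nonneg fun i _ => hpS0 _)
    (fun l s v u => ∏ i, q l (s i) (fun j => (v j).map (fun x => x i)) (u i))
    (fun l s v u => Finset.prod_nonneg fun i _ => hq0 _ _ _ _)
    (fun l s v => by
      rw [sum_pi_prod (fun (i : Fin n) x => q l (s i) (fun j => (v j).map (fun x => x i)) x)]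
      exact Finset.prod_eq_one fun i _ => hq1 _ _ _)
    (fun l v u => ∏ i, Qk l (fun j => (v j).map (fun x => x i)) (u i))
    (fun l v u => Finset.prod_nonneg fun i _ => condK_nonneg _ _ _ _ _)
    (fun l v => by
      rw [sum_pi_prod (fun (i : Fin n) x => Qk l (fun j => (v j).map (fun x => x i)) x)]
      exact Finset.prod_eq_one fun i _ => condK_sum _ _ _ _)
    (fun l _ => u0 l) M (fun l => (hfb l).2.1) (fun u i => g (u i)) cost B
    (fun s z => mul_nonneg (by positivity) (Finset.sum_nonneg fun i _ => hd _ _))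
    (fun s z => by
      have h1 := Finset.sum_le_sum fun (i : Fin n) (_ : i ∈ Finset.univ) =>
        hdB (φ (fun l => s l i)) (z i)
      simp only [Finset.sum_const, Finset.card_univ, Fintype.card_fin, nsmul_eq_mul] at h1
      calc cost s z ≤ (n : ℝ)⁻¹ * (n * B) := mul_le_mul_of_nonneg_left h1 (by positivity)
        _ = B := by field_simp)
  refine ⟨n, hn, c, fun l => ?_, ?_⟩
  · rw [hcM]
    exact (hfb l).2.2
  have hLHS : expect (iidPMF n pS hpS0 hpS1) (avgDistortion φ d c) =
      ∑ s : ∀ l, Fin n → S l, (∏ i, pS (fun l => s l i)) *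
        cost s (c.dec (msg c s (L + 1))) := by
    rw [expect, ← Equiv.sum_comp (Equiv.piComm (fun (_ : Fin n) l => S l))]
    rfl
  rw [hLHS]
  refine hcD.trans ?_
  rw [← Fintype.sum_prod_type', ← Equiv.sum_comp (blockEquiv n S U)]
  simp only [pv_map, nx_map]
  have hbound : ∀ ω : Fin n → (∀ l, S l) × (∀ l, U l),
      (∏ i, pS (fun l => (blockEquiv n S U ω).1 l i)) *
        (∏ l, ∏ i, q l ((blockEquiv n S U ω).1 l i)
          (pv l (fun j => (blockEquiv n S U ω).2 j i)) ((blockEquiv n S U ω).2 l i)) *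
        (cost (blockEquiv n S U ω).1 (fun i => g ((blockEquiv n S U ω).2 (Fin.last L) i)) +
          B * ∑ l, (∏ i, q l ((blockEquiv n S U ω).1 l i)
            (pv l (fun j => (blockEquiv n S U ω).2 j i)) ((blockEquiv n S U ω).2 l i)) /
            ((∏ i, q l ((blockEquiv n S U ω).1 l i)
              (pv l (fun j => (blockEquiv n S U ω).2 j i)) ((blockEquiv n S U ω).2 l i)) +
              M l * ∏ i, Qk l (nx l (fun j => (blockEquiv n S U ω).1 j i))
                ((blockEquiv n S U ω).2 l i))) ≤
      (∏ i, μ.p (ω i)) * ((n : ℝ)⁻¹ * ∑ i, d (φ (ω i).1) (g ((ω i).2 (Fin.last L)))) +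
        B * ∑ l, ∏ i, (μ.p (ω i) * Real.exp (t l * f l (ω i))) := by
    intro ω
    have hw : (∏ i, pS (fun l => (blockEquiv n S U ω).1 l i)) *
        (∏ l, ∏ i, q l ((blockEquiv n S U ω).1 l i)
          (pv l (fun j => (blockEquiv n S U ω).2 j i)) ((blockEquiv n S U ω).2 l i)) =
        ∏ i, μ.p (ω i) := by
      rw [Finset.prod_comm, ← Finset.prod_mul_distrib]
      exact Finset.prod_congr rfl fun i _ => (hfact' (ω i)).symm
    rw [hw, mul_add]
    refine add_le_add (le_of_eq rfl) ?_
    rw [mul_left_comm]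
    refine mul_le_mul_of_nonneg_left ?_ hB0
    rw [Finset.mul_sum]
    refine Finset.sum_le_sum fun l _ => ?_
    exact block_ratio μ (fun ω => q l (ω.1 l) (pv l ω.2) (ω.2 l))
      (fun ω => Qk l (nx l ω.1) (ω.2 l)) (hqpos l) (hQpos l) ((R l + ε / 2) * Real.log 2) (t l)
      (M l) (ht0 l) (ht1 l) (hfb l).1 ω
  refine (Finset.sum_le_sum fun ω _ => hbound ω).trans ?_
  rw [Finset.sum_add_distrib, sum_iid_avg μ hn
    (fun ω => d (φ ω.1) (g (ω.2 (Fin.last L)))), ← Finset.mul_sum, Finset.sum_comm]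
  simp_rw [fun l => sum_iid_pow (n := n) (fun ω => μ.p ω * Real.exp (t l * f l ω))]
  have h1 : ∑ ω, μ.p ω * d (φ ω.1) (g (ω.2 (Fin.last L))) ≤ D := hdist
  have h2 : B * ∑ l, (∑ ω, μ.p ω * Real.exp (t l * f l ω)) ^ n < ε := hn1
  linarith

end Cascade
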